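/- arXiv:2508.01404 — 3 statements merged into one kernel-verified Lean document; each statement's English description precedes it below -/
import Mathlib

section
/- Let a simple hexagon (encoded as in the context) satisfy ℓ₀ = ℓ₁ = ℓ₃ = ℓ₄, A₀ = A₂, A₃ = A₅ and A₀ + A₂ + A₄ = 2π. Then ℓ₂ = ℓ₅, A₀ = A₃, A₁ = A₄, A₂ = A₅, and edges 0 and 3 are parallel as opposite sides. -/
/-- The direction angle of edge `k`: `φₖ = k·π − (A₁ + ⋯ + Aₖ)` (so `φ₀ = 0`). -/
noncomputable def hexPhi (A : Fin 6 → ℝ) (k : Fin 6) : ℝ :=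
  (k : ℕ) * Real.pi -
    ∑ j ∈ Finset.univ.filter (fun j : Fin 6 => 1 ≤ (j : ℕ) ∧ (j : ℕ) ≤ (k : ℕ)), A j

/-- The closure equation `∑ₖ ℓₖ·exp(I·φₖ) = 0`. -/
def HexClosure (ℓ A : Fin 6 → ℝ) : Prop :=
  ∑ k : Fin 6, (ℓ k : ℂ) * Complex.exp (Complex.I * (hexPhi A k : ℂ)) = 0

/-- The vertices `P_m = ∑_{k<m} ℓₖ·exp(I·φₖ)`. -/
noncomputable def hexVertex (ℓ A : Fin 6 → ℝ) (m : Fin 6) : ℂ :=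
  ∑ k ∈ Finset.univ.filter (fun k : Fin 6 => (k : ℕ) < (m : ℕ)),
    (ℓ k : ℂ) * Complex.exp (Complex.I * (hexPhi A k : ℂ))

/-- Edge `k`: the closed segment from `P_k` to `P_{k+1}` (indices mod 6). -/
noncomputable def hexEdge (ℓ A : Fin 6 → ℝ) (k : Fin 6) : Set ℂ :=
  segment ℝ (hexVertex ℓ A k) (hexVertex ℓ A (k + 1))

/-- Simplicity: non-adjacent edges are disjoint, and adjacent edges meet only in
their common endpoint. -/
def HexSimple (ℓ A : Fin 6 → ℝ) : Prop :=
  (∀ j k : Fin 6, j ≠ k → k ≠ j + 1 → j ≠ k + 1 →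
    Disjoint (hexEdge ℓ A j) (hexEdge ℓ A k)) ∧
  (∀ k : Fin 6, hexEdge ℓ A k ∩ hexEdge ℓ A (k + 1) = {hexVertex ℓ A (k + 1)})

/-- Edges `k` and `k+3` are parallel as opposite sides: `exp(I·φₖ) = −exp(I·φ_{k+3})`. -/
def HexParallelOpp (A : Fin 6 → ℝ) (k : Fin 6) : Prop :=
  Complex.exp (Complex.I * (hexPhi A k : ℂ)) =
    - Complex.exp (Complex.I * (hexPhi A (k + 3) : ℂ))


theorem exp_I_mul_re_im (x : ℝ) :
    Complex.exp (Complex.I * (x : ℂ)) = ⟨Real.cos x, Real.sin x⟩ := by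
  rw [mul_comm]
  exact Complex.ext (Complex.exp_ofReal_mul_I_re x) (Complex.exp_ofReal_mul_I_im x)

/-- The law of sines in vector form: three unit vectors turning by exterior angles `π - α` and
`π - β`, weighted by the sines of the opposite angles, sum to zero. -/
theorem sin_smul_exp_triangle (α β φ : ℝ) :
    (Real.sin β : ℂ) * Complex.exp (Complex.I * (φ : ℂ))
      + (Real.sin (α + β) : ℂ) * Complex.exp (Complex.I * ((φ + (Real.pi - α) : ℝ) : ℂ))
      + (Real.sin α : ℂ) *
        Complex.exp (Complex.I * ((φ + (2 * Real.pi - α - β) : ℝ) : ℂ)) = 0 := by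
  have h1 : φ + (Real.pi - α) = (φ - α) + Real.pi := by ring
  have h2 : φ + (2 * Real.pi - α - β) = (φ - (α + β)) + 2 * Real.pi := by ring
  have h3 : Real.sin β = Real.sin (α + β) * Real.cos α - Real.cos (α + β) * Real.sin α := by
    rw [← Real.sin_sub]; congr 1; ring
  rw [exp_I_mul_re_im, exp_I_mul_re_im, exp_I_mul_re_im, h1, h2, h3, Real.cos_add_pi,
    Real.sin_add_pi, Real.cos_add_two_pi, Real.sin_add_two_pi, Real.cos_sub φ α,
    Real.sin_sub φ α, Real.cos_sub φ (α + β), Real.sin_sub φ (α + β)]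
  apply Complex.ext
  · simp only [Complex.add_re, Complex.re_ofReal_mul, Complex.zero_re]; ring
  · simp only [Complex.add_im, Complex.im_ofReal_mul, Complex.zero_im]; ring

/-- If the two sides of length `s` erected on a base of length `p` at angles `α` and `β` are long
enough to reach the apex of the triangle, then they meet. -/
theorem not_disjoint_segment_of_triangle {α β φ s p : ℝ} {V₁ V₂ V₃ V₄ : ℂ}
    (hs : 0 < s) (hp : 0 < p) (hα : 0 ≤ Real.sin α) (hβ : 0 ≤ Real.sin β)
    (hαβ : 0 < Real.sin (α + β))
    (hle : p * (Real.sin α + Real.sin β) ≤ s * Real.sin (α + β))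
    (h₁₂ : V₂ = V₁ + (s : ℂ) * Complex.exp (Complex.I * (φ : ℂ)))
    (h₂₃ : V₃ = V₂ + (p : ℂ) * Complex.exp (Complex.I * ((φ + (Real.pi - α) : ℝ) : ℂ)))
    (h₃₄ : V₄ = V₃ +
      (s : ℂ) * Complex.exp (Complex.I * ((φ + (2 * Real.pi - α - β) : ℝ) : ℂ))) :
    ¬ Disjoint (segment ℝ V₁ V₂) (segment ℝ V₃ V₄) := by
  have htri := sin_smul_exp_triangle α β φ
  generalize Real.sin α = x at *
  generalize Real.sin β = y at *
  generalize Complex.exp (Complex.I * (φ : ℂ)) = e₁ at *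
  generalize Complex.exp (Complex.I * ((φ + (Real.pi - α) : ℝ) : ℂ)) = e₂ at *
  generalize Complex.exp (Complex.I * ((φ + (2 * Real.pi - α - β) : ℝ) : ℂ)) = e₃ at *
  generalize Real.sin (α + β) = S at *
  have hsS : 0 < s * S := mul_pos hs hαβ
  have hx : p * y ≤ s * S := by nlinarith
  have hy : p * x ≤ s * S := by nlinarith
  have hx1 : p * y / (s * S) ≤ 1 := (div_le_one hsS).2 hx
  have hy1 : p * x / (s * S) ≤ 1 := (div_le_one hsS).2 hy
  have hs' : (s : ℂ) ≠ 0 := by exact_mod_cast hs.ne'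
  have hS' : (S : ℂ) ≠ 0 := by exact_mod_cast hαβ.ne'
  rw [Set.not_disjoint_iff]
  refine ⟨V₃ + ((p * x / (s * S) : ℝ) : ℂ) * (V₄ - V₃), ?_, ?_⟩
  · refine ⟨p * y / (s * S), 1 - p * y / (s * S), by positivity,
      by linarith, by ring, ?_⟩
    subst h₃₄ h₂₃ h₁₂
    simp only [Complex.real_smul]
    push_cast
    field_simp
    linear_combination (-(p : ℂ) * s) * htri
  · refine ⟨1 - p * x / (s * S), p * x / (s * S), by linarith,
      by positivity, by ring, ?_⟩
    simp only [Complex.real_smul]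
    push_cast
    ring

/-- The half-angle estimate behind the self-intersection: if the closing relation holds with
`a ≠ b`, then the shorter of the two sides `p`, `q` satisfies the triangle bound. -/
theorem triangle_bound_of_closing {a b s p q : ℝ} (ha : 0 < a) (ha' : a < Real.pi)
    (hb : 0 < b) (hb' : b < Real.pi) (hab : a ≠ b) (hs : 0 < s) (hp : 0 < p) (hpq : p ≤ q)
    (h : (p + q) * Real.sin (b - a) = 2 * s * (Real.sin b - Real.sin a)) :
    0 < Real.sin (a + b) ∧
      p * (Real.sin a + Real.sin b) ≤ s * Real.sin (a + b) := by
  obtain ⟨u, hu⟩ : ∃ u, u = (a + b) / 2 := ⟨_, rfl⟩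
  obtain ⟨v, hv⟩ : ∃ v, v = (b - a) / 2 := ⟨_, rfl⟩
  obtain rfl : a = u - v := by rw [hu, hv]; ring
  obtain rfl : b = u + v := by linarith
  have hv0 : Real.sin v ≠ 0 := by
    intro h0
    have := (Real.sin_eq_zero_iff_of_lt_of_lt (by linarith) (by linarith)).1 h0
    exact hab (by rw [this]; ring)
  have hcv : 0 < Real.cos v := Real.cos_pos_of_mem_Ioo ⟨by linarith, by linarith⟩
  have hsu : 0 < Real.sin u := Real.sin_pos_of_pos_of_lt_pi (by linarith) (by linarith)
  have hd : u + v - (u - v) = 2 * v := by ring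
  have he : u - v + (u + v) = 2 * u := by ring
  rw [hd, Real.sin_two_mul, Real.sin_add, Real.sin_sub] at h
  have hkey : (p + q) * Real.cos v = 2 * s * Real.cos u :=
    mul_left_cancel₀ hv0 (by linear_combination h / 2)
  have hle : p * Real.cos v ≤ s * Real.cos u := by nlinarith
  have hcu : 0 < Real.cos u := by
    have : 0 < s * Real.cos u := lt_of_lt_of_le (mul_pos hp hcv) hle
    exact (mul_pos_iff_of_pos_left hs).1 this
  rw [he, Real.sin_two_mul, Real.sin_add, Real.sin_sub]
  refine ⟨by positivity, ?_⟩
  nlinarith [mul_le_mul_of_nonneg_left hle hsu.le]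

/-- Real and imaginary parts of the closure equation, rotated by `-b`. -/
theorem closing_relations {a b s p q : ℝ}
    (h : (s : ℂ) * Complex.exp (Complex.I * ((0 : ℝ) : ℂ))
      + (s : ℂ) * Complex.exp (Complex.I * ((2 * b - Real.pi : ℝ) : ℂ))
      + (p : ℂ) * Complex.exp (Complex.I * ((2 * b - a : ℝ) : ℂ))
      + (s : ℂ) * Complex.exp (Complex.I * ((b - a + Real.pi : ℝ) : ℂ))
      + (s : ℂ) * Complex.exp (Complex.I * ((a + b : ℝ) : ℂ))
      + (q : ℂ) * Complex.exp (Complex.I * ((a + Real.pi : ℝ) : ℂ)) = 0) :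
    (p - q) * Real.cos (b - a) = 0 ∧
      (p + q) * Real.sin (b - a) = 2 * s * (Real.sin b - Real.sin a) := by
  have h2 : 2 * b - a = b + (b - a) := by ring
  simp only [exp_I_mul_re_im] at h
  have hre := congrArg Complex.re h
  have him := congrArg Complex.im h
  simp only [Complex.add_re, Complex.re_ofReal_mul, Complex.zero_re, Real.cos_pi,
    Real.sin_pi, Real.cos_zero, h2, Real.cos_add, Real.cos_sub, Real.sin_sub,
    Real.cos_two_mul] at hre
  simp only [Complex.add_im, Complex.im_ofReal_mul, Complex.zero_im, Real.cos_pi,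
    Real.sin_pi, Real.sin_zero, h2, Real.sin_add, Real.cos_sub, Real.sin_sub,
    Real.sin_two_mul] at him
  have hb := Real.sin_sq_add_cos_sq b
  rw [Real.cos_sub, Real.sin_sub]
  generalize Real.sin a = x at *
  generalize Real.cos a = y at *
  generalize Real.sin b = z at *
  generalize Real.cos b = w at *
  constructor
  · linear_combination w * hre + z * him + (2 * w * s - p * (w * y + z * x)) * hb
  · linear_combination w * him - z * hre - (2 * x * s + p * (z * y - w * x)) * hb

theorem stmt8 (ℓ A : Fin 6 → ℝ)
    (hlen : ∀ k, 0 < ℓ k)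
    (hang_pos : ∀ i, 0 < A i) (hang_lt : ∀ i, A i < 2 * Real.pi)
    (hang_sum : A 0 + A 1 + A 2 + A 3 + A 4 + A 5 = 4 * Real.pi)
    (hclose : HexClosure ℓ A)
    (hsimple : HexSimple ℓ A)
    (h01 : ℓ 0 = ℓ 1) (h13 : ℓ 1 = ℓ 3) (h34 : ℓ 3 = ℓ 4)
    (hA02 : A 0 = A 2) (hA35 : A 3 = A 5)
    (h024 : A 0 + A 2 + A 4 = 2 * Real.pi) :
    ℓ 2 = ℓ 5 ∧ A 0 = A 3 ∧ A 1 = A 4 ∧ A 2 = A 5 ∧ HexParallelOpp A 0 := by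
  have hA4 : A 4 = 2 * Real.pi - 2 * A 0 := by linarith
  have hA1 : A 1 = 2 * Real.pi - 2 * A 3 := by linarith
  have hA0π : A 0 < Real.pi := by linarith [hang_pos 4]
  have hA3π : A 3 < Real.pi := by linarith [hang_pos 1]
  have f0 : hexPhi A 0 = 0 := by
    simp [hexPhi, Finset.sum_filter, Fin.sum_univ_six]
  have f1 : hexPhi A 1 = 2 * A 3 - Real.pi := by
    simp [hexPhi, Finset.sum_filter, Fin.sum_univ_six]; linarith
  have f2 : hexPhi A 2 = 2 * A 3 - A 0 := by
    simp [hexPhi, Finset.sum_filter, Fin.sum_univ_six]; linarith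
  have f3 : hexPhi A 3 = A 3 - A 0 + Real.pi := by
    simp [hexPhi, Finset.sum_filter, Fin.sum_univ_six]; linarith
  have f4 : hexPhi A 4 = A 0 + A 3 := by
    simp [hexPhi, Finset.sum_filter, Fin.sum_univ_six]; linarith
  have f5 : hexPhi A 5 = A 0 + Real.pi := by
    simp [hexPhi, Finset.sum_filter, Fin.sum_univ_six]; linarith
  have v1 : hexVertex ℓ A 1 = hexVertex ℓ A 0 +
      (ℓ 0 : ℂ) * Complex.exp (Complex.I * (hexPhi A 0 : ℂ)) := by
    simp [hexVertex, Finset.sum_filter]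
  have v2 : hexVertex ℓ A 2 = hexVertex ℓ A 1 +
      (ℓ 1 : ℂ) * Complex.exp (Complex.I * (hexPhi A 1 : ℂ)) := by
    simp [hexVertex, Finset.sum_filter, Fin.sum_univ_six]
  have v3 : hexVertex ℓ A 3 = hexVertex ℓ A 2 +
      (ℓ 2 : ℂ) * Complex.exp (Complex.I * (hexPhi A 2 : ℂ)) := by
    simp [hexVertex, Finset.sum_filter, Fin.sum_univ_six]
  have v4 : hexVertex ℓ A 4 = hexVertex ℓ A 3 +
      (ℓ 3 : ℂ) * Complex.exp (Complex.I * (hexPhi A 3 : ℂ)) := by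
    simp [hexVertex, Finset.sum_filter, Fin.sum_univ_six]
  have v5 : hexVertex ℓ A 5 = hexVertex ℓ A 4 +
      (ℓ 4 : ℂ) * Complex.exp (Complex.I * (hexPhi A 4 : ℂ)) := by
    simp [hexVertex, Finset.sum_filter, Fin.sum_univ_six]
  have v0 : hexVertex ℓ A 0 = hexVertex ℓ A 5 +
      (ℓ 5 : ℂ) * Complex.exp (Complex.I * (hexPhi A 5 : ℂ)) := by
    rw [HexClosure, Fin.sum_univ_six] at hclose
    rw [v5, v4, v3, v2, v1]
    linear_combination -hclose
  rw [HexClosure, Fin.sum_univ_six, f0, f1, f2, f3, f4, f5, ← h34, ← h13, ← h01] at hclose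
  obtain ⟨hre, him⟩ := closing_relations hclose
  have ha := hang_pos 0
  have hb := hang_pos 3
  have hsa : 0 ≤ Real.sin (A 0) := (Real.sin_pos_of_pos_of_lt_pi ha hA0π).le
  have hsb : 0 ≤ Real.sin (A 3) := (Real.sin_pos_of_pos_of_lt_pi hb hA3π).le
  have hab : A 0 = A 3 := by
    by_contra hab
    rcases le_total (ℓ 2) (ℓ 5) with hle | hle
    · obtain ⟨hS, hbd⟩ :=
        triangle_bound_of_closing ha hA0π hb hA3π hab (hlen 0) (hlen 2) hle him
      refine not_disjoint_segment_of_triangle (φ := hexPhi A 1) (hlen 0) (hlen 2) hsa hsb hS hbd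
        (V₁ := hexVertex ℓ A 1) (V₂ := hexVertex ℓ A 2) (V₃ := hexVertex ℓ A 3)
        (V₄ := hexVertex ℓ A 4) ?_ ?_ ?_ (hsimple.1 1 3 (by decide) (by decide) (by decide))
      · rw [h01]; exact v2
      · convert v3 using 6; linarith
      · rw [h01, h13]; convert v4 using 6; linarith
    · rw [add_comm (ℓ 2)] at him
      obtain ⟨hS, hbd⟩ :=
        triangle_bound_of_closing ha hA0π hb hA3π hab (hlen 0) (hlen 5) hle him
      rw [add_comm (A 0)] at hS hbd
      rw [add_comm (Real.sin _)] at hbd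
      refine not_disjoint_segment_of_triangle (φ := hexPhi A 4) (hlen 0) (hlen 5) hsb hsa hS hbd
        (V₁ := hexVertex ℓ A 4) (V₂ := hexVertex ℓ A 5) (V₃ := hexVertex ℓ A 0)
        (V₄ := hexVertex ℓ A 1) ?_ ?_ ?_ (hsimple.1 4 0 (by decide) (by decide) (by decide))
      · rw [h01, h13, h34]; exact v5
      · convert v0 using 6; linarith
      · have h2π : hexPhi A 4 + (2 * Real.pi - A 3 - A 0) = hexPhi A 0 + 2 * Real.pi := by
          linarith
        rw [v1, h2π, exp_I_mul_re_im, exp_I_mul_re_im, Real.cos_add_two_pi,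
          Real.sin_add_two_pi]
  refine ⟨?_, hab, by linarith, by linarith, ?_⟩
  · rw [hab, sub_self, Real.cos_zero] at hre
    linarith
  · rw [HexParallelOpp, zero_add, f0, f3, hab, sub_self, zero_add, mul_comm _ (Real.pi : ℂ),
      Complex.exp_pi_mul_I]
    simp
end

section
/- Let a simple hexagon (encoded as in the context) satisfy ℓ₀ = ℓ₁ = ℓ₅, ℓ₂ = ℓ₃ = ℓ₄, A₀ = A₄, A₁ = A₃ and A₀ + A₃ + A₄ = 2π. Then ℓ₀ = ℓ₂, i.e. the hexagon is equilateral (and since A₁ + A₂ + A₅ = 2π holds by the angle sum, it is a type-2 Reinhardt hexagon). -/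
open scoped ComplexConjugate in
/-- A unit complex number `u` has `1 + u - u² = -u² · conj (1 - u - u²)`, so the two factors have the
same norm. -/
theorem norm_one_add_sub_sq_eq {u : ℂ} (hu : ‖u‖ = 1) : ‖1 + u - u ^ 2‖ = ‖1 - u - u ^ 2‖ := by
  have h : u * conj u = 1 := by simp [Complex.mul_conj, Complex.normSq_eq_norm_sq, hu]
  have key : 1 + u - u ^ 2 = -u ^ 2 * conj (1 - u - u ^ 2) := by
    simp only [map_sub, map_one, map_pow]
    linear_combination (-u - u * conj u - 1) * h
  rw [key, norm_mul, norm_neg, norm_pow, hu, Complex.norm_conj, one_pow, one_mul]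

/-- The roots of `1 - u - u²` are not on the unit circle. -/
theorem one_sub_sub_sq_ne_zero {u : ℂ} (hu : ‖u‖ = 1) : 1 - u - u ^ 2 ≠ 0 := by
  intro h
  have h' : 1 + u - u ^ 2 = 0 := by
    rw [← norm_eq_zero, norm_one_add_sub_sq_eq hu, h, norm_zero]
  have hu0 : u = 0 := by linear_combination (h' - h) / 2
  simp [hu0] at hu

/-- Direction vectors in terms of `exp (α i)` and `exp (-γ i)`, up to sign. -/
theorem exp_I_mul_combination (α γ : ℝ) (n : ℤ) (m k : ℕ) :
    Complex.exp (Complex.I * ((n * Real.pi + m * α - k * γ : ℝ) : ℂ)) =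
      (-1) ^ n * Complex.exp (α * Complex.I) ^ m * Complex.exp ((-γ : ℝ) * Complex.I) ^ k := by
  rw [← Complex.exp_pi_mul_I, ← Complex.exp_int_mul, ← Complex.exp_nat_mul, ← Complex.exp_nat_mul,
    ← Complex.exp_add, ← Complex.exp_add]
  congr 1
  push_cast
  ring

theorem stmt10 (ℓ A : Fin 6 → ℝ)
    (hlen : ∀ k, 0 < ℓ k)
    (hang_pos : ∀ i, 0 < A i) (hang_lt : ∀ i, A i < 2 * Real.pi)
    (hang_sum : A 0 + A 1 + A 2 + A 3 + A 4 + A 5 = 4 * Real.pi)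
    (hclose : HexClosure ℓ A)
    (hsimple : HexSimple ℓ A)
    (h01 : ℓ 0 = ℓ 1) (h05 : ℓ 0 = ℓ 5) (h23 : ℓ 2 = ℓ 3) (h24 : ℓ 2 = ℓ 4)
    (hA04 : A 0 = A 4) (hA13 : A 1 = A 3)
    (h034 : A 0 + A 3 + A 4 = 2 * Real.pi) :
    ℓ 0 = ℓ 2 ∧ ∀ k, ℓ k = ℓ 0 := by
  have p (k : Fin 6) (n : ℤ) (m j : ℕ) (h : hexPhi A k = n * Real.pi + m * A 0 - j * A 2) :
      Complex.exp (Complex.I * (hexPhi A k : ℂ)) =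
        (-1) ^ n * Complex.exp (A 0 * Complex.I) ^ m *
          Complex.exp ((-A 2 : ℝ) * Complex.I) ^ j := by
    rw [h, exp_I_mul_combination]
  have p0 := p 0 0 0 0 (by simp [hexPhi, Finset.sum_filter, Fin.sum_univ_succ])
  have p1 := p 1 (-1) 2 0 (by
    simp [hexPhi, Finset.sum_filter, Fin.sum_univ_six]; linarith)
  have p2 := p 2 0 2 1 (by
    simp [hexPhi, Finset.sum_filter, Fin.sum_univ_six]; linarith)
  have p3 := p 3 (-1) 4 1 (by
    simp [hexPhi, Finset.sum_filter, Fin.sum_univ_six]; linarith)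
  have p4 := p 4 0 3 1 (by
    simp [hexPhi, Finset.sum_filter, Fin.sum_univ_six]; linarith)
  have p5 := p 5 1 1 0 (by
    simp [hexPhi, Finset.sum_filter, Fin.sum_univ_six]; linarith)
  have hu : ‖Complex.exp (A 0 * Complex.I)‖ = 1 := Complex.norm_exp_ofReal_mul_I _
  have hw : ‖Complex.exp ((-A 2 : ℝ) * Complex.I)‖ = 1 := Complex.norm_exp_ofReal_mul_I _
  rw [HexClosure, Fin.sum_univ_six, p0, p1, p2, p3, p4, p5, ← h01, ← h05, ← h23, ← h24] at hclose
  generalize Complex.exp (A 0 * Complex.I) = u at hclose hu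
  generalize Complex.exp ((-A 2 : ℝ) * Complex.I) = w at hclose hw
  have key : (ℓ 0 : ℂ) * (1 - u - u ^ 2) = -((ℓ 2 : ℂ) * w * u ^ 2 * (1 + u - u ^ 2)) := by
    norm_num at hclose
    linear_combination hclose
  have hnorm := congrArg norm key
  simp only [norm_neg, norm_mul, norm_pow, hu, hw, norm_one_add_sub_sq_eq hu, Complex.norm_real,
    Real.norm_eq_abs, abs_of_pos (hlen _), one_pow, mul_one] at hnorm
  have h02 : ℓ 0 = ℓ 2 :=
    mul_right_cancel₀ (norm_ne_zero_iff.mpr (one_sub_sub_sq_ne_zero hu)) hnorm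
  refine ⟨h02, fun k => ?_⟩
  fin_cases k <;> simp <;> linarith
end

section
/- Let a hexagon (encoded as in the context) satisfy ℓ₀ = ℓ₁ = ℓ₃ = ℓ₅ = 1, ℓ₂ = a, ℓ₄ = b, A₀ = A₂ = A₄ = 2π − 2α, A₁ = 4α − 2π and A₃ = A₅ = α (the angle constraints force π/2 < α < π). Then a = 4·cos²α + 2·cos α + 1 and b = −4·cos α − 1. -/
/-- The real and imaginary parts of the closure equation. -/
theorem HexClosure.cos_sin {ℓ A : Fin 6 → ℝ} (h : HexClosure ℓ A) :
    ∑ k, ℓ k * Real.cos (hexPhi A k) = 0 ∧ ∑ k, ℓ k * Real.sin (hexPhi A k) = 0 := by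
  have hre := congrArg Complex.re h
  have him := congrArg Complex.im h
  simp only [mul_comm Complex.I, Complex.re_sum, Complex.im_sum, Complex.re_ofReal_mul,
    Complex.im_ofReal_mul, Complex.exp_ofReal_mul_I_re, Complex.exp_ofReal_mul_I_im,
    Complex.zero_re, Complex.zero_im] at hre him
  exact ⟨hre, him⟩

theorem cos_four_mul_eq (x : ℝ) :
    Real.cos (4 * x) = 8 * Real.cos x ^ 4 - 8 * Real.cos x ^ 2 + 1 := by
  rw [show 4 * x = 2 * (2 * x) by ring, Real.cos_two_mul, Real.cos_two_mul]
  ring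

theorem sin_four_mul_eq (x : ℝ) :
    Real.sin (4 * x) = Real.sin x * (8 * Real.cos x ^ 3 - 4 * Real.cos x) := by
  rw [show 4 * x = 2 * (2 * x) by ring, Real.sin_two_mul, Real.sin_two_mul, Real.cos_two_mul]
  ring

theorem sin_three_mul_eq (x : ℝ) :
    Real.sin (3 * x) = Real.sin x * (4 * Real.cos x ^ 2 - 1) := by
  rw [Real.sin_three_mul]
  linear_combination (-4 * Real.sin x) * Real.sin_sq_add_cos_sq x

theorem stmt14 (ℓ A : Fin 6 → ℝ) (a b α : ℝ)
    (hlen : ∀ k, 0 < ℓ k)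
    (hang_pos : ∀ i, 0 < A i) (hang_lt : ∀ i, A i < 2 * Real.pi)
    (hang_sum : A 0 + A 1 + A 2 + A 3 + A 4 + A 5 = 4 * Real.pi)
    (hclose : HexClosure ℓ A)
    (hl0 : ℓ 0 = 1) (hl1 : ℓ 1 = 1) (hl3 : ℓ 3 = 1) (hl5 : ℓ 5 = 1)
    (hl2 : ℓ 2 = a) (hl4 : ℓ 4 = b)
    (hA0 : A 0 = 2 * Real.pi - 2 * α) (hA2 : A 2 = 2 * Real.pi - 2 * α)
    (hA4 : A 4 = 2 * Real.pi - 2 * α)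
    (hA1 : A 1 = 4 * α - 2 * Real.pi)
    (hA3 : A 3 = α) (hA5 : A 5 = α) :
    a = 4 * Real.cos α ^ 2 + 2 * Real.cos α + 1 ∧
    b = -4 * Real.cos α - 1 := by
  have hsin : Real.sin α ≠ 0 := by
    refine (Real.sin_pos_of_pos_of_lt_pi ?_ ?_).ne'
    · linarith [hang_pos 3]
    · linarith [hang_pos 0]
  have p0 : hexPhi A 0 = 0 := by
    simp [hexPhi, Finset.sum_filter, Fin.sum_univ_six]
  have p1 : hexPhi A 1 = Real.pi - 4 * α + 2 * Real.pi := by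
    simp [hexPhi, Finset.sum_filter, Fin.sum_univ_six, hA1]; ring
  have p2 : hexPhi A 2 = 2 * Real.pi - 2 * α := by
    simp [hexPhi, Finset.sum_filter, Fin.sum_univ_six, hA1, hA2]; ring
  have p3 : hexPhi A 3 = Real.pi - 3 * α + 2 * Real.pi := by
    simp [hexPhi, Finset.sum_filter, Fin.sum_univ_six, hA1, hA2, hA3]; ring
  have p4 : hexPhi A 4 = 2 * Real.pi - α := by
    simp [hexPhi, Finset.sum_filter, Fin.sum_univ_six, hA1, hA2, hA3, hA4]; ring
  have p5 : hexPhi A 5 = Real.pi - 2 * α + 2 * Real.pi := by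
    simp [hexPhi, Finset.sum_filter, Fin.sum_univ_six, hA1, hA2, hA3, hA4, hA5]; ring
  obtain ⟨hcos, him⟩ := hclose.cos_sin
  simp only [Fin.sum_univ_six, p0, p1, p2, p3, p4, p5, hl0, hl1, hl2, hl3, hl4, hl5,
    Real.cos_add_two_pi, Real.sin_add_two_pi, Real.cos_pi_sub, Real.sin_pi_sub,
    Real.cos_two_pi_sub, Real.sin_two_pi_sub, Real.cos_zero, Real.sin_zero,
    cos_four_mul_eq, sin_four_mul_eq, Real.cos_three_mul, sin_three_mul_eq,
    Real.cos_two_mul, Real.sin_two_mul] at hcos him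
  set c := Real.cos α
  have hlin : 2 * c * a + b = 8 * c ^ 3 + 4 * c ^ 2 - 2 * c - 1 := by
    apply mul_left_cancel₀ hsin
    linear_combination -him
  have ha : a = 4 * c ^ 2 + 2 * c + 1 := by
    linear_combination c * hlin - hcos
  refine ⟨ha, ?_⟩
  linear_combination hlin - 2 * c * ha
end
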